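/- Let f : ℝ → ℝ be a C³ function and γ : ℝ → ℝ a C³ curve with γ'(0) ≠ 0 and f'(γ(0)) ≠ 0. Then lim_{ε→0} ( CR_{f∘γ}(ε) − CR_γ(ε) ) / ε² = γ'(0)² · (3·f''(γ(0))² − 2·f'(γ(0))·f'''(γ(0))) / f'(γ(0))². (This is the identity from the paper's introduction: the Schwarzian derivative of f appears as the second-order infinitesimal deformation of the anharmonic ratio of the four points γ(0), γ(ε), γ(2ε), γ(3ε) under f; here the points are given by an arbitrary curve γ through the base point, contributing the factor γ'(0)².) -/

import Mathlib

/-- The anharmonic (cross) ratio of the four points `u(0), u(ε), u(2ε), u(3ε)` on a curve `u`: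
`CR_u(ε) = ((u(0) − u(2ε))·(u(ε) − u(3ε))) / ((u(0) − u(ε))·(u(2ε) − u(3ε)))`. -/
noncomputable def curveCrossRatio (u : ℝ → ℝ) (ε : ℝ) : ℝ :=
  ((u 0 - u (2 * ε)) * (u ε - u (3 * ε))) / ((u 0 - u ε) * (u (2 * ε) - u (3 * ε)))

open Filter Topology in
/-- Third-order Taylor expansion at the origin, in Peano form. -/
theorem exists_taylor_three_tendsto {u : ℝ → ℝ} (hu : ContDiff ℝ 3 u) :
    ∃ s : ℝ → ℝ, Tendsto s (𝓝[≠] 0) (𝓝 (iteratedDeriv 3 u 0 / 6)) ∧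
      ∀ x, u x = u 0 + deriv u 0 * x + iteratedDeriv 2 u 0 / 2 * x ^ 2 + s x * x ^ 3 := by
  refine ⟨fun x => (u x - u 0 - deriv u 0 * x - iteratedDeriv 2 u 0 / 2 * x ^ 2) / x ^ 3, ?_, ?_⟩
  · have h := Real.taylor_tendsto (n := 3) convex_univ (Set.mem_univ 0) hu.contDiffOn
    rw [nhdsWithin_univ] at h
    have h' := (h.mono_left (nhdsWithin_le_nhds (s := {0}ᶜ))).add_const (iteratedDeriv 3 u 0 / 6)
    rw [zero_add] at h'
    refine h'.congr' ?_
    filter_upwards [self_mem_nhdsWithin] with x hx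
    have hx : x ≠ 0 := hx
    simp only [taylor_within_apply, Finset.sum_range_succ, Finset.sum_range_zero,
      iteratedDerivWithin_univ, iteratedDeriv_zero, iteratedDeriv_one, smul_eq_mul, sub_zero,
      Nat.factorial]
    field_simp
    push_cast
    ring
  · intro x
    rcases eq_or_ne x 0 with rfl | hx
    · simp
    · field_simp
      ring

open Filter Topology in
/-- The second-order expansion of the cross-ratio of equally spaced points on a curve: the
coefficient is `-2` times the Schwarzian derivative of the curve. -/
theorem tendsto_curveCrossRatio_sub_four_div_sq {u : ℝ → ℝ} (hu : ContDiff ℝ 3 u)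
    (hu' : deriv u 0 ≠ 0) :
    Tendsto (fun ε : ℝ => (curveCrossRatio u ε - 4) / ε ^ 2) (𝓝[≠] 0)
      (𝓝 ((3 * iteratedDeriv 2 u 0 ^ 2 - 2 * deriv u 0 * iteratedDeriv 3 u 0)
        / deriv u 0 ^ 2)) := by
  obtain ⟨s, hs, hus⟩ := exists_taylor_three_tendsto hu
  set a := deriv u 0
  set b := iteratedDeriv 2 u 0
  set c := iteratedDeriv 3 u 0
  have hmul : ∀ k : ℝ, k ≠ 0 → Tendsto (fun ε => s (k * ε)) (𝓝[≠] 0) (𝓝 (c / 6)) := by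
    intro k hk
    refine hs.comp (tendsto_nhdsWithin_iff.2 ⟨?_, ?_⟩)
    · have : Tendsto (fun ε : ℝ => k * ε) (𝓝 0) (𝓝 (k * 0)) := tendsto_id.const_mul k
      rw [mul_zero] at this
      exact this.mono_left nhdsWithin_le_nhds
    · filter_upwards [self_mem_nhdsWithin] with x hx
      exact mul_ne_zero hk hx
  have hε : Tendsto (fun ε : ℝ => ε) (𝓝[≠] 0) (𝓝 0) := nhdsWithin_le_nhds
  have hlim : Tendsto (fun ε : ℝ => (ε, s ε, s (2 * ε), s (3 * ε))) (𝓝[≠] 0)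
      (𝓝 (0, c / 6, c / 6, c / 6)) :=
    hε.prodMk_nhds (hs.prodMk_nhds
      ((hmul 2 two_ne_zero).prodMk_nhds (hmul 3 three_ne_zero)))
  let N : ℝ × ℝ × ℝ × ℝ → ℝ := fun p =>
    a * (-54 * p.2.2.2 + 48 * p.2.2.1 - 6 * p.2.1) + 3 * b ^ 2
      + b / 2 * (96 * p.2.2.1 - 24 * p.2.1) * p.1
      + (8 * p.2.2.1 * (27 * p.2.2.2 - p.2.1)
        - 4 * p.2.1 * (27 * p.2.2.2 - 8 * p.2.2.1)) * p.1 ^ 2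
  let D₁ : ℝ × ℝ × ℝ × ℝ → ℝ := fun p => a + b / 2 * p.1 + p.2.1 * p.1 ^ 2
  let D₂ : ℝ × ℝ × ℝ × ℝ → ℝ := fun p =>
    a + 5 * b / 2 * p.1 + (27 * p.2.2.2 - 8 * p.2.2.1) * p.1 ^ 2
  have hN : Tendsto (fun ε => N (ε, s ε, s (2 * ε), s (3 * ε))) (𝓝[≠] 0)
      (𝓝 (3 * b ^ 2 - 2 * a * c)) := by
    have : Continuous N := by fun_prop
    rw [show 3 * b ^ 2 - 2 * a * c = N (0, c / 6, c / 6, c / 6) by simp only [N]; ring]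
    exact (this.tendsto _).comp hlim
  have hD₁ : Tendsto (fun ε => D₁ (ε, s ε, s (2 * ε), s (3 * ε))) (𝓝[≠] 0) (𝓝 a) := by
    have : Continuous D₁ := by fun_prop
    rw [show a = D₁ (0, c / 6, c / 6, c / 6) by simp [D₁]]
    exact (this.tendsto _).comp hlim
  have hD₂ : Tendsto (fun ε => D₂ (ε, s ε, s (2 * ε), s (3 * ε))) (𝓝[≠] 0) (𝓝 a) := by
    have : Continuous D₂ := by fun_prop
    rw [show a = D₂ (0, c / 6, c / 6, c / 6) by simp [D₂]]
    exact (this.tendsto _).comp hlim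
  have hND := hN.div (hD₁.mul hD₂) (mul_ne_zero hu' hu')
  rw [← pow_two] at hND
  refine hND.congr' ?_
  filter_upwards [self_mem_nhdsWithin, hD₁.eventually_ne hu', hD₂.eventually_ne hu']
    with ε hε h₁ h₂
  have hε : ε ≠ 0 := hε
  have e₁ : u 0 - u ε = -ε * D₁ (ε, s ε, s (2 * ε), s (3 * ε)) := by
    rw [hus ε]
    simp only [D₁]
    ring
  have e₂ : u (2 * ε) - u (3 * ε) = -ε * D₂ (ε, s ε, s (2 * ε), s (3 * ε)) := by
    rw [hus (2 * ε), hus (3 * ε)]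
    simp only [D₂]
    ring
  have e₃ : (u 0 - u (2 * ε)) * (u ε - u (3 * ε)) =
      ε ^ 2 * (4 * (D₁ (ε, s ε, s (2 * ε), s (3 * ε)) * D₂ (ε, s ε, s (2 * ε), s (3 * ε)))
        + ε ^ 2 * N (ε, s ε, s (2 * ε), s (3 * ε))) := by
    rw [hus ε, hus (2 * ε), hus (3 * ε)]
    simp only [D₁, D₂, N]
    ring
  simp only [Pi.div_apply]
  rw [curveCrossRatio, e₁, e₂, e₃]
  clear e₁ e₂ e₃
  generalize D₁ (ε, s ε, s (2 * ε), s (3 * ε)) = d₁ at h₁ ⊢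
  generalize D₂ (ε, s ε, s (2 * ε), s (3 * ε)) = d₂ at h₂ ⊢
  generalize N (ε, s ε, s (2 * ε), s (3 * ε)) = n
  field_simp
  ring

/-- The first three derivatives of a composition of `C³` functions of a real variable. -/
theorem deriv_comp_upto_three {f g : ℝ → ℝ} (hf : ContDiff ℝ 3 f) (hg : ContDiff ℝ 3 g) (x : ℝ) :
    deriv (f ∘ g) x = deriv f (g x) * deriv g x ∧
    iteratedDeriv 2 (f ∘ g) x =
      iteratedDeriv 2 f (g x) * deriv g x ^ 2 + deriv f (g x) * iteratedDeriv 2 g x ∧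
    iteratedDeriv 3 (f ∘ g) x =
      iteratedDeriv 3 f (g x) * deriv g x ^ 3
        + 3 * iteratedDeriv 2 f (g x) * deriv g x * iteratedDeriv 2 g x
        + deriv f (g x) * iteratedDeriv 3 g x := by
  have key : ∀ {h : ℝ → ℝ}, ContDiff ℝ 3 h → ∀ y, HasDerivAt h (deriv h y) y ∧
      HasDerivAt (deriv h) (iteratedDeriv 2 h y) y ∧
      HasDerivAt (iteratedDeriv 2 h) (iteratedDeriv 3 h y) y := by
    intro h hh y
    refine ⟨(hh.differentiable (by norm_num) y).hasDerivAt, ?_, ?_⟩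
    · have := (hh.differentiable_iteratedDeriv 1 (by norm_num) y).hasDerivAt
      rwa [← iteratedDeriv_succ, iteratedDeriv_one] at this
    · have := (hh.differentiable_iteratedDeriv 2 (by norm_num) y).hasDerivAt
      rwa [← iteratedDeriv_succ] at this
  have d₁ : deriv (f ∘ g) = fun y => deriv f (g y) * deriv g y :=
    funext fun y => ((key hf (g y)).1.comp y (key hg y).1).deriv
  have d₂ : iteratedDeriv 2 (f ∘ g) = fun y =>
      iteratedDeriv 2 f (g y) * deriv g y ^ 2 + deriv f (g y) * iteratedDeriv 2 g y := by
    rw [iteratedDeriv_succ, iteratedDeriv_one, d₁]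
    funext y
    obtain ⟨g₁, g₂, -⟩ := key hg y
    have := (((key hf (g y)).2.1.comp y g₁).mul g₂).deriv
    refine this.trans ?_
    simp only [Function.comp_apply]
    ring
  refine ⟨congrFun d₁ x, congrFun d₂ x, ?_⟩
  rw [iteratedDeriv_succ, d₂]
  obtain ⟨g₁, g₂, g₃⟩ := key hg x
  obtain ⟨-, f₂, f₃⟩ := key hf (g x)
  refine (((f₃.comp x g₁).mul (g₂.pow 2)).add ((f₂.comp x g₁).mul g₃)).deriv.trans ?_
  simp only [Function.comp_apply, Pi.pow_apply]
  push_cast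
  ring

/-- **The Schwarzian as infinitesimal deformation of the anharmonic ratio.** Let `f : ℝ → ℝ`
be `C³` and `γ : ℝ → ℝ` a `C³` curve with `γ'(0) ≠ 0` and `f'(γ(0)) ≠ 0`. Then
`lim_{ε→0} (CR_{f∘γ}(ε) − CR_γ(ε))/ε²
  = γ'(0)² · (3·f''(γ(0))² − 2·f'(γ(0))·f'''(γ(0)))/f'(γ(0))²`. -/
theorem schwarzian_deformation_of_anharmonic_ratio
    (f γ : ℝ → ℝ) (hf : ContDiff ℝ 3 f) (hγ : ContDiff ℝ 3 γ)
    (hγ' : deriv γ 0 ≠ 0) (hf' : deriv f (γ 0) ≠ 0) :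
    Filter.Tendsto
      (fun ε : ℝ => (curveCrossRatio (f ∘ γ) ε - curveCrossRatio γ ε) / ε ^ 2)
      (nhdsWithin 0 {0}ᶜ)
      (nhds (deriv γ 0 ^ 2 *
        ((3 * iteratedDeriv 2 f (γ 0) ^ 2 - 2 * deriv f (γ 0) * iteratedDeriv 3 f (γ 0))
          / deriv f (γ 0) ^ 2))) := by
  obtain ⟨h₁, h₂, h₃⟩ := deriv_comp_upto_three hf hγ 0
  have hcomp : deriv (f ∘ γ) 0 ≠ 0 := h₁ ▸ mul_ne_zero hf' hγ'
  have h := (tendsto_curveCrossRatio_sub_four_div_sq (hf.comp hγ) hcomp).sub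
    (tendsto_curveCrossRatio_sub_four_div_sq hγ hγ')
  rw [h₁, h₂, h₃] at h
  convert h using 2
  · ring
  · field_simp
    ring
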